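/- If an n-qubit pure state |ψ⟩⟨ψ| and a mixed (non-pure) n-qubit density matrix ω have the same (n−1)-qubit reduced density matrices (partial trace over each single qubit j, for all j = 1,…,n), then there exists a pure state |ψ'⟩⟨ψ'| ≠ |ψ⟩⟨ψ| with the same (n−1)-qubit reduced density matrices as |ψ⟩. -/

import Mathlib

open Matrix
open scoped ComplexOrder

/-- Insert the bit `b` into slot `j` of the partial assignment `x` of bits to
the qubits other than `j`. -/
def emb {n : ℕ} (j : Fin n) (x : {k : Fin n // k ≠ j} → Fin 2) (b : Fin 2) :
    Fin n → Fin 2 :=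
  fun k => if h : k = j then b else x ⟨k, h⟩

/-- The partial trace of an `n`-qubit operator over qubit `j`, an operator on
the remaining `n−1` qubits. -/
noncomputable def ptrace {n : ℕ} (j : Fin n) (ρ : Matrix (Fin n → Fin 2) (Fin n → Fin 2) ℂ) :
    Matrix ({k : Fin n // k ≠ j} → Fin 2) ({k : Fin n // k ≠ j} → Fin 2) ℂ :=
  fun x y => ∑ b : Fin 2, ρ (emb j x b) (emb j y b)

/-- |ψ⟩⟨ψ| as a matrix. -/
noncomputable def proj {m : Type*} (ψ : m → ℂ) : Matrix m m ℂ :=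
  Matrix.vecMulVec ψ (star ψ)

/-- The operator acting as the `2 × 2` matrix `A` on qubit `j` and trivially on the others. -/
noncomputable def localOp {n : ℕ} (j : Fin n) (A : Matrix (Fin 2) (Fin 2) ℂ)
    (φ : (Fin n → Fin 2) → ℂ) : (Fin n → Fin 2) → ℂ :=
  fun x => ∑ c, A (x j) c * φ (Function.update x j c)

section LocalOp

variable {n : ℕ} (j : Fin n)

lemma emb_self (x : {k : Fin n // k ≠ j} → Fin 2) (b : Fin 2) : emb j x b j = b := by
  simp [emb]

lemma update_emb (x : {k : Fin n // k ≠ j} → Fin 2) (b c : Fin 2) :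
    Function.update (emb j x b) j c = emb j x c := by
  ext k
  by_cases h : k = j
  · subst h; simp [emb]
  · simp [emb, h]

lemma sum_emb {M : Type*} [AddCommMonoid M] (F : (Fin n → Fin 2) → M) :
    ∑ x, F x = ∑ u, ∑ b, F (emb j u b) := by
  rw [← (Equiv.funSplitAt j (Fin 2)).symm.sum_comp F, Fintype.sum_prod_type, Finset.sum_comm]
  refine Finset.sum_congr rfl fun u _ => Finset.sum_congr rfl fun b _ => congrArg F ?_
  ext k
  by_cases h : k = j
  · subst h; simp [emb]
  · simp [emb, h]

lemma localOp_emb (A : Matrix (Fin 2) (Fin 2) ℂ) (φ : (Fin n → Fin 2) → ℂ)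
    (u : {k : Fin n // k ≠ j} → Fin 2) (b : Fin 2) :
    localOp j A φ (emb j u b) = ∑ c, A b c * φ (emb j u c) := by
  simp [localOp, emb_self, update_emb]

lemma localOp_one (φ : (Fin n → Fin 2) → ℂ) : localOp j 1 φ = φ := by
  ext x
  simp [localOp, Matrix.one_apply]

lemma localOp_zero_right (A : Matrix (Fin 2) (Fin 2) ℂ) :
    localOp j A (0 : (Fin n → Fin 2) → ℂ) = 0 := by
  ext x
  simp [localOp]

lemma localOp_add_left (A B : Matrix (Fin 2) (Fin 2) ℂ) (φ : (Fin n → Fin 2) → ℂ) :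
    localOp j (A + B) φ = localOp j A φ + localOp j B φ := by
  ext x
  simp only [localOp, Matrix.add_apply, add_mul, Finset.sum_add_distrib, Pi.add_apply]

lemma localOp_smul_left (a : ℂ) (A : Matrix (Fin 2) (Fin 2) ℂ) (φ : (Fin n → Fin 2) → ℂ) :
    localOp j (a • A) φ = a • localOp j A φ := by
  ext x
  simp only [localOp, Matrix.smul_apply, smul_eq_mul, mul_assoc, Finset.mul_sum, Pi.smul_apply]

lemma localOp_sub_left (A B : Matrix (Fin 2) (Fin 2) ℂ) (φ : (Fin n → Fin 2) → ℂ) :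
    localOp j (A - B) φ = localOp j A φ - localOp j B φ := by
  ext x
  simp only [localOp, Matrix.sub_apply, sub_mul, Finset.sum_sub_distrib, Pi.sub_apply]

lemma localOp_mul (A B : Matrix (Fin 2) (Fin 2) ℂ) (φ : (Fin n → Fin 2) → ℂ) :
    localOp j (A * B) φ = localOp j A (localOp j B φ) := by
  ext x
  simp only [localOp, Matrix.mul_apply, Fin.sum_univ_two, Function.update_self,
    Function.update_idem]
  ring

lemma localOp_comm {i j : Fin n} (h : i ≠ j) (A B : Matrix (Fin 2) (Fin 2) ℂ)
    (φ : (Fin n → Fin 2) → ℂ) :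
    localOp i A (localOp j B φ) = localOp j B (localOp i A φ) := by
  ext x
  simp only [localOp, Fin.sum_univ_two, Function.update_of_ne h, Function.update_of_ne h.symm,
    Function.update_comm h]
  ring

lemma star_localOp_dotProduct (A : Matrix (Fin 2) (Fin 2) ℂ) (η φ : (Fin n → Fin 2) → ℂ) :
    star (localOp j A η) ⬝ᵥ φ = star η ⬝ᵥ localOp j Aᴴ φ := by
  simp only [dotProduct, sum_emb j, Pi.star_apply, localOp_emb, Fin.sum_univ_two,
    Matrix.conjTranspose_apply, star_add, star_mul']
  refine Finset.sum_congr rfl fun u _ => ?_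
  ring

/-- Operators on qubit `j` as a linear map into state vectors. -/
noncomputable def localOpLin (φ : (Fin n → Fin 2) → ℂ) :
    Matrix (Fin 2) (Fin 2) ℂ →ₗ[ℂ] (Fin n → Fin 2) → ℂ where
  toFun A := localOp j A φ
  map_add' A B := localOp_add_left j A B φ
  map_smul' a A := localOp_smul_left j a A φ

lemma sum_dotProduct_localOp_single (b : Fin 2) (η : (Fin n → Fin 2) → ℂ)
    (ρ : Matrix (Fin n → Fin 2) (Fin n → Fin 2) ℂ) :
    ∑ c, star (localOp j (Matrix.single c b 1) η) ⬝ᵥ (ρ *ᵥ localOp j (Matrix.single c b 1) η) =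
      ∑ u, ∑ v, star (η (emb j u b)) * ptrace j ρ u v * η (emb j v b) := by
  simp only [dotProduct, mulVec, sum_emb j, Pi.star_apply, localOp_emb, Matrix.single_apply, ptrace]
  simp only [ite_and, ite_mul, one_mul, zero_mul, Finset.sum_ite_irrel, Finset.sum_ite_eq,
    Finset.mem_univ, if_true, Finset.sum_const_zero, apply_ite star, star_zero, mul_ite, mul_zero]
  rw [Finset.sum_comm]
  refine Finset.sum_congr rfl fun u _ => ?_
  simp only [Finset.mul_sum, Finset.sum_mul]
  rw [Finset.sum_comm]
  simp [mul_assoc]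

lemma ptrace_proj_localOp {U : Matrix (Fin 2) (Fin 2) ℂ} (hU : Uᴴ * U = 1)
    (φ : (Fin n → Fin 2) → ℂ) : ptrace j (proj (localOp j U φ)) = ptrace j (proj φ) := by
  have h (a b : Fin 2) := congrFun (congrFun hU a) b
  have h00 := h 0 0
  have h01 := h 0 1
  have h10 := h 1 0
  have h11 := h 1 1
  simp [Matrix.mul_apply, Fin.sum_univ_two] at h00 h01 h10 h11
  ext x y
  simp only [ptrace, proj, Matrix.vecMulVec_apply, Pi.star_apply, localOp_emb, Fin.sum_univ_two,
    star_add, star_mul', RCLike.star_def]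
  set p := φ (emb j x 0)
  set q := φ (emb j x 1)
  set r := (starRingEnd ℂ) (φ (emb j y 0))
  set s := (starRingEnd ℂ) (φ (emb j y 1))
  linear_combination p * r * h00 + q * r * h01 + p * s * h10 + q * s * h11

end LocalOp

lemma proj_mulVec {m : Type*} [Fintype m] (ψ v : m → ℂ) :
    proj ψ *ᵥ v = (star ψ ⬝ᵥ v) • ψ := by
  simp [proj, Matrix.vecMulVec_mulVec]

/-- Vectors in the range of a state `ω` sharing the reduced state of `ψ` on the complement of
qubit `j` arise from `ψ` by an operation on qubit `j`. -/
lemma exists_localOp_eq_mulVec {n : ℕ} (j : Fin n) (ψ : (Fin n → Fin 2) → ℂ)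
    {ω : Matrix (Fin n → Fin 2) (Fin n → Fin 2) ℂ} (hω : ω.PosSemidef)
    (h : ptrace j (proj ψ) = ptrace j ω) (v : (Fin n → Fin 2) → ℂ) :
    ∃ A, ω *ᵥ v = localOp j A ψ := by
  by_contra hcon
  have hmem : ω *ᵥ v ∉ LinearMap.range (localOpLin j ψ) := by
    rintro ⟨A, hA⟩
    exact hcon ⟨A, hA.symm⟩
  obtain ⟨f, hf, hker⟩ := Submodule.exists_le_ker_of_notMem hmem
  obtain ⟨η, hη⟩ : ∃ η : (Fin n → Fin 2) → ℂ, ∀ w, f w = star η ⬝ᵥ w := by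
    refine ⟨fun x => star (f (Pi.single x 1)), fun w => ?_⟩
    rw [LinearMap.pi_apply_eq_sum_univ f w]
    simp only [dotProduct, Pi.star_apply, star_star, smul_eq_mul]
    refine Finset.sum_congr rfl fun x _ => ?_
    rw [mul_comm]
    congr 2
    ext y
    simp [Pi.single_apply, eq_comm]
  have hηA (A) : star η ⬝ᵥ localOp j A ψ = 0 := by
    rw [← hη]
    exact hker ⟨A, rfl⟩
  have hzero (b : Fin 2) : ω *ᵥ localOp j (Matrix.single b b 1) η = 0 := by
    have hsum := sum_dotProduct_localOp_single j b η (proj ψ)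
    rw [h, ← sum_dotProduct_localOp_single] at hsum
    have hψ (c : Fin 2) : star (localOp j (Matrix.single c b 1) η) ⬝ᵥ
        (proj ψ *ᵥ localOp j (Matrix.single c b 1) η) = 0 := by
      rw [proj_mulVec, dotProduct_smul, star_localOp_dotProduct, hηA, smul_zero]
    rw [Finset.sum_congr rfl fun c _ => hψ c, Finset.sum_const_zero, eq_comm,
      Finset.sum_eq_zero_iff_of_nonneg fun c _ => hω.dotProduct_mulVec_nonneg _] at hsum
    exact (hω.dotProduct_mulVec_zero_iff _).1 (hsum b (Finset.mem_univ b))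
  have hωη : ω *ᵥ η = 0 := by
    have : η = ∑ b, localOp j (Matrix.single b b 1) η := by
      conv_lhs => rw [← localOp_one j η]
      rw [Fin.sum_univ_two, ← localOp_add_left]
      congr 1
      ext a b
      fin_cases a <;> fin_cases b <;> simp
    rw [this, Matrix.mulVec_sum]
    simp [hzero]
  apply hf
  have := congrArg star hωη
  rw [Matrix.star_mulVec, hω.1.eq, star_zero] at this
  rw [hη, dotProduct_mulVec, this, zero_dotProduct]

lemma exists_unit_smul {m : Type*} [Fintype m] {v : m → ℂ} (hv : v ≠ 0) :
    ∃ c : ℂ, c ≠ 0 ∧ star (c • v) ⬝ᵥ (c • v) = 1 := by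
  have hpos : 0 < star v ⬝ᵥ v := Matrix.dotProduct_star_self_pos_iff.2 hv
  obtain ⟨hre, him⟩ := Complex.pos_iff.1 hpos
  set r := (star v ⬝ᵥ v).re
  have hrv : star v ⬝ᵥ v = (r : ℂ) := Complex.ext rfl (by simpa using him.symm)
  have hs : (Real.sqrt r : ℂ) * Real.sqrt r = r := by
    rw [← Complex.ofReal_mul, Real.mul_self_sqrt hre.le]
  have hs0 : (Real.sqrt r : ℂ) ≠ 0 := by
    exact_mod_cast (Real.sqrt_pos.2 hre).ne'
  refine ⟨(Real.sqrt r : ℂ)⁻¹, inv_ne_zero hs0, ?_⟩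
  rw [star_smul, smul_dotProduct, dotProduct_smul, hrv, ← hs]
  simp only [RCLike.star_def, map_inv₀, Complex.conj_ofReal, smul_eq_mul]
  field_simp

lemma exists_mulVec_notMem_span {m : Type*} [Fintype m] {ω : Matrix m m ℂ} (h : 2 ≤ ω.rank)
    (χ : m → ℂ) : ∃ v, ω *ᵥ v ∉ Submodule.span ℂ {χ} := by
  by_contra! hcon
  have hle : LinearMap.range ω.mulVecLin ≤ Submodule.span ℂ {χ} := by
    rintro _ ⟨v, rfl⟩
    exact hcon v
  have h1 := Submodule.finrank_mono hle
  have h2 := finrank_span_le_card (R := ℂ) ({χ} : Set (m → ℂ))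
  simp only [Set.toFinset_singleton, Finset.card_singleton] at h2
  have h3 : ω.rank = Module.finrank ℂ (LinearMap.range ω.mulVecLin) := rfl
  omega

lemma proj_mul_self {m : Type*} [Fintype m] {v : m → ℂ} (hv : star v ⬝ᵥ v = 1) :
    proj v * proj v = proj v := by
  simp [proj, Matrix.vecMulVec_mul_vecMulVec, hv]

lemma conjTranspose_proj {m : Type*} (v : m → ℂ) : (proj v)ᴴ = proj v := by
  simp [proj, Matrix.conjTranspose_vecMulVec]

lemma eq_smul_of_proj_eq {m : Type*} [Fintype m] {v w : m → ℂ} (hv : star v ⬝ᵥ v = 1)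
    (h : proj v = proj w) : ∃ c : ℂ, v = c • w := by
  refine ⟨star w ⬝ᵥ v, ?_⟩
  rw [← proj_mulVec, ← h, proj_mulVec, hv, one_smul]

/-- The affine line through a pure state and a mixed state supported on a plane containing it
leaves the set of states at a second pure state. -/
lemma exists_proj_on_line {m : Type*} [Fintype m] [DecidableEq m] {ψ φ : m → ℂ}
    (hψ : star ψ ⬝ᵥ ψ = 1) {ω : Matrix m m ℂ} (hω : ω.PosSemidef) (htr : ω.trace = 1)
    (hrank : 2 ≤ ω.rank) (hspan : ∀ v, ∃ a b : ℂ, ω *ᵥ v = a • ψ + b • φ) :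
    ∃ ψ' : m → ℂ, star ψ' ⬝ᵥ ψ' = 1 ∧ proj ψ' ≠ proj ψ ∧
      ∃ t : ℂ, proj ψ' = proj ψ + t • (ω - proj ψ) := by
  wlog hφ : star φ ⬝ᵥ φ = 1 ∧ star ψ ⬝ᵥ φ = 0 generalizing φ
  · set φ₀ := φ - (star ψ ⬝ᵥ φ) • ψ with hφ₀
    have hne : φ₀ ≠ 0 := by
      intro h0
      obtain ⟨v, hv⟩ := exists_mulVec_notMem_span hrank ψ
      obtain ⟨a, b, hab⟩ := hspan v
      rw [sub_eq_zero.1 h0] at hab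
      refine hv (Submodule.mem_span_singleton.2 ⟨a + b * (star ψ ⬝ᵥ φ), ?_⟩)
      rw [hab, add_smul, mul_smul]
    obtain ⟨c, hc, hcφ⟩ := exists_unit_smul hne
    refine this (φ := c • φ₀) (fun v => ?_) ⟨hcφ, ?_⟩
    · obtain ⟨a, b, hab⟩ := hspan v
      refine ⟨a + b * (star ψ ⬝ᵥ φ), b * c⁻¹, ?_⟩
      rw [hab, hφ₀, smul_smul, mul_assoc, inv_mul_cancel₀ hc]
      module
    · rw [dotProduct_smul, hφ₀, dotProduct_sub, dotProduct_smul, hψ]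
      simp
  obtain ⟨hφ, hψφ⟩ := hφ
  have hφψ : star φ ⬝ᵥ ψ = 0 := by
    have := congrArg star hψφ
    rwa [Matrix.star_dotProduct, star_star, star_zero] at this
  have hdec (v) : ω *ᵥ v = (star ψ ⬝ᵥ (ω *ᵥ v)) • ψ + (star φ ⬝ᵥ (ω *ᵥ v)) • φ := by
    obtain ⟨a, b, hab⟩ := hspan v
    simp [hab, dotProduct_add, dotProduct_smul, hψ, hφ, hψφ, hφψ]
  have hadj (v w : m → ℂ) : star v ⬝ᵥ (ω *ᵥ w) = star (star w ⬝ᵥ (ω *ᵥ v)) := by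
    rw [dotProduct_mulVec, Matrix.star_dotProduct, Matrix.star_mulVec, hω.1.eq, star_star]
  set p := star ψ ⬝ᵥ (ω *ᵥ ψ)
  set q := star φ ⬝ᵥ (ω *ᵥ φ) with hq
  set z := star φ ⬝ᵥ (ω *ᵥ ψ) with hz
  have hps : star p = p := (hadj ψ ψ).symm
  have hqs : star q = q := (hadj φ φ).symm
  have hωψ : ω *ᵥ ψ = p • ψ + z • φ := hdec ψ
  have hωφ : ω *ᵥ φ = star z • ψ + q • φ := by
    rw [hz, ← hadj]
    exact hdec φ
  have hω_apply (x y : m) : ω x y =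
      ψ x * (p * star (ψ y) + star z * star (φ y)) + φ x * (z * star (ψ y) + q * star (φ y)) := by
    have h := congrFun (hdec (Pi.single y 1)) x
    rw [hadj ψ, hadj φ, hωψ, hωφ] at h
    simp only [Matrix.mulVec_single_one, Matrix.col_apply, Pi.add_apply, Pi.smul_apply,
      smul_eq_mul, Pi.star_single, star_one, single_one_dotProduct, star_add, star_mul',
      star_star, hps, hqs] at h
    rw [h]
    ring
  have hpq : p + q = 1 := by
    have h : ω.trace = p * (star ψ ⬝ᵥ ψ) + star z * (star φ ⬝ᵥ ψ) +
        z * (star ψ ⬝ᵥ φ) + q * (star φ ⬝ᵥ φ) := by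
      simp only [Matrix.trace, Matrix.diag_apply, hω_apply, dotProduct, Finset.mul_sum,
        ← Finset.sum_add_distrib, Pi.star_apply]
      exact Finset.sum_congr rfl fun x _ => by ring
    rw [htr, hψ, hφ, hψφ, hφψ] at h
    linear_combination -h
  have hq0 : q ≠ 0 := by
    intro h0
    have hωφ0 : ω *ᵥ φ = 0 := (hω.dotProduct_mulVec_zero_iff φ).1 h0
    obtain ⟨v, hv⟩ := exists_mulVec_notMem_span hrank ψ
    refine hv (Submodule.mem_span_singleton.2 ⟨star ψ ⬝ᵥ (ω *ᵥ v), ?_⟩)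
    conv_rhs => rw [hdec v, hadj φ v, hωφ0]
    simp
  have hne : ω *ᵥ φ ≠ 0 := by
    intro h0
    rw [hq, h0, dotProduct_zero] at hq0
    exact hq0 rfl
  obtain ⟨c, hc, hcunit⟩ := exists_unit_smul hne
  have hnorm : star c * c * (z * star z + q * q) = 1 := by
    rw [← hcunit, hωφ]
    simp only [star_smul, star_add, smul_dotProduct, dotProduct_smul, add_dotProduct,
      dotProduct_add, hψ, hφ, hψφ, hφψ, star_star, hqs, smul_eq_mul]
    ring
  have hline : proj (c • ω *ᵥ φ) = proj ψ + (star c * c * q) • (ω - proj ψ) := by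
    ext x y
    simp only [hωφ, proj, Matrix.vecMulVec_apply, Matrix.add_apply, Matrix.smul_apply,
      Matrix.sub_apply, Pi.smul_apply, Pi.star_apply, Pi.add_apply, smul_eq_mul, hω_apply,
      star_mul', star_add, star_star, hqs]
    linear_combination ψ x * star (ψ y) * hnorm -
      star c * c * q * ψ x * star (ψ y) * hpq
  refine ⟨c • ω *ᵥ φ, hcunit, fun heq => ?_, _, hline⟩
  have hzero : (star c * c * q) • (ω - proj ψ) = 0 := by
    rw [heq] at hline
    simpa using hline.symm
  have hωproj : ω = proj ψ :=
    sub_eq_zero.1 ((smul_eq_zero.1 hzero).resolve_left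
      (mul_ne_zero (mul_ne_zero (star_ne_zero.2 hc) hc) hq0))
  obtain ⟨v, hv⟩ := exists_mulVec_notMem_span hrank ψ
  rw [hωproj, proj_mulVec] at hv
  exact hv (Submodule.mem_span_singleton.2 ⟨_, rfl⟩)

/-- The commutant of a nonscalar `2 × 2` matrix is spanned by the identity and the matrix. -/
lemma exists_eq_of_commute_of_ne_smul_one {K : Type*} [Field K] {A B : Matrix (Fin 2) (Fin 2) K}
    (hAB : A * B = B * A) (hA : ∀ c : K, A ≠ c • 1) : ∃ x y : K, B = x • 1 + y • A := by
  have h (a b : Fin 2) := congrFun (congrFun hAB a) b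
  have h00 := h 0 0
  have h01 := h 0 1
  have h10 := h 1 0
  simp only [Matrix.mul_apply, Fin.sum_univ_two] at h00 h01 h10
  suffices ∃ y, B 0 1 = y * A 0 1 ∧ B 1 0 = y * A 1 0 ∧ B 0 0 - B 1 1 = y * (A 0 0 - A 1 1) by
    obtain ⟨y, h1, h2, h3⟩ := this
    refine ⟨B 0 0 - y * A 0 0, y, ?_⟩
    ext a b
    fin_cases a <;> fin_cases b <;> simp [h1, h2]
    linear_combination -h3
  by_cases hb : A 0 1 = 0
  · by_cases hc : A 1 0 = 0
    · have hd : A 0 0 - A 1 1 ≠ 0 := by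
        intro hd
        apply hA (A 0 0)
        ext a b
        fin_cases a <;> fin_cases b <;> simp [hb, hc, sub_eq_zero.1 hd]
      refine ⟨(B 0 0 - B 1 1) / (A 0 0 - A 1 1), ?_, ?_, ?_⟩ <;> field_simp
      · linear_combination h01
      · linear_combination -h10
    · refine ⟨B 1 0 / A 1 0, ?_, ?_, ?_⟩ <;> field_simp
      · linear_combination -h00
      · linear_combination h10
  · refine ⟨B 0 1 / A 0 1, ?_, ?_, ?_⟩ <;> field_simp
    · linear_combination h00
    · linear_combination -h01

section Qubits

variable {n : ℕ} {ψ : (Fin n → Fin 2) → ℂ} {ω : Matrix (Fin n → Fin 2) (Fin n → Fin 2) ℂ}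

/-- If a mixed state shares its reduced states with `ψ`, then every qubit of `ψ` is entangled with
the rest: no nonzero operator on a single qubit annihilates `ψ`. -/
lemma eq_zero_of_localOp_eq_zero {i j : Fin n} (hij : i ≠ j) (hω : ω.PosSemidef)
    (hrank : 2 ≤ ω.rank) (hsame : ∀ j, ptrace j (proj ψ) = ptrace j ω)
    {A : Matrix (Fin 2) (Fin 2) ℂ} (hA : localOp i A ψ = 0) : A = 0 := by
  by_contra hne
  obtain ⟨b, d, hbd⟩ : ∃ b d, A b d ≠ 0 := by
    by_contra! h0
    exact hne (Matrix.ext h0)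
  have hrow {φ : (Fin n → Fin 2) → ℂ} (h : localOp i A φ = 0) (x) :
      A b 0 * φ (Function.update x i 0) + A b 1 * φ (Function.update x i 1) = 0 := by
    simpa [localOp] using congrFun h (Function.update x i b)
  obtain ⟨v, hv⟩ := exists_mulVec_notMem_span hrank ψ
  obtain ⟨B, hB⟩ := exists_localOp_eq_mulVec i ψ hω (hsame i) v
  obtain ⟨C, hC⟩ := exists_localOp_eq_mulVec j ψ hω (hsame j) v
  set φ := ω *ᵥ v
  have hAφ : localOp i A φ = 0 := by
    rw [hC, localOp_comm hij, hA, localOp_zero_right]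
  have hBφ (x) (c : Fin 2) : φ (Function.update x i c) =
      B c 0 * ψ (Function.update x i 0) + B c 1 * ψ (Function.update x i 1) := by
    simpa [localOp] using congrFun hB (Function.update x i c)
  have hupd {k : ℂ} (h : ∀ x c, φ (Function.update x i c) = k * ψ (Function.update x i c)) :
      False := by
    refine hv (Submodule.mem_span_singleton.2 ⟨k, ?_⟩)
    ext x
    simpa using (h x (x i)).symm
  fin_cases d
  · replace hbd : A b 0 ≠ 0 := hbd
    have hsolve {θ : (Fin n → Fin 2) → ℂ} (h : localOp i A θ = 0) (x) :
        θ (Function.update x i 0) = -(A b 1 / A b 0) * θ (Function.update x i 1) := by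
      field_simp
      linear_combination hrow h x
    have h1 (x) : φ (Function.update x i 1) =
        (B 1 1 - B 1 0 * (A b 1 / A b 0)) * ψ (Function.update x i 1) := by
      rw [hBφ, hsolve hA]
      ring
    refine hupd (k := B 1 1 - B 1 0 * (A b 1 / A b 0)) fun x c => ?_
    fin_cases c
    · change φ (Function.update x i 0) = _ * ψ (Function.update x i 0)
      rw [hsolve hAφ, hsolve hA, h1]
      ring
    · exact h1 x
  · replace hbd : A b 1 ≠ 0 := hbd
    have hsolve {θ : (Fin n → Fin 2) → ℂ} (h : localOp i A θ = 0) (x) :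
        θ (Function.update x i 1) = -(A b 0 / A b 1) * θ (Function.update x i 0) := by
      field_simp
      linear_combination hrow h x
    have h0 (x) : φ (Function.update x i 0) =
        (B 0 0 - B 0 1 * (A b 0 / A b 1)) * ψ (Function.update x i 0) := by
      rw [hBφ, hsolve hA]
      ring
    refine hupd (k := B 0 0 - B 0 1 * (A b 0 / A b 1)) fun x c => ?_
    fin_cases c
    · exact h0 x
    · change φ (Function.update x i 1) = _ * ψ (Function.update x i 1)
      rw [hsolve hAφ, hsolve hA, h0]
      ring

/-- On three or more qubits, a mixed state sharing its reduced states with `ψ` is supported on a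
plane containing `ψ`. -/
lemma exists_plane_of_ptrace_eq {i j k : Fin n} (hij : i ≠ j) (hik : i ≠ k) (hjk : j ≠ k)
    (hω : ω.PosSemidef) (hrank : 2 ≤ ω.rank) (hsame : ∀ j, ptrace j (proj ψ) = ptrace j ω) :
    ∃ φ : (Fin n → Fin 2) → ℂ, ∀ v, ∃ a b : ℂ, ω *ᵥ v = a • ψ + b • φ := by
  have hinj {A B : Matrix (Fin 2) (Fin 2) ℂ} (h : localOp i A ψ = localOp i B ψ) : A = B :=
    sub_eq_zero.1 (eq_zero_of_localOp_eq_zero hij hω hrank hsame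
      (by rw [localOp_sub_left, h, sub_self]))
  obtain ⟨v₀, hv₀⟩ := exists_mulVec_notMem_span hrank ψ
  refine ⟨ω *ᵥ v₀, fun v => ?_⟩
  obtain ⟨A, hA⟩ := exists_localOp_eq_mulVec i ψ hω (hsame i) v₀
  obtain ⟨A', hA'⟩ := exists_localOp_eq_mulVec k ψ hω (hsame k) v₀
  obtain ⟨B, hB⟩ := exists_localOp_eq_mulVec i ψ hω (hsame i) v
  obtain ⟨B', hB'⟩ := exists_localOp_eq_mulVec j ψ hω (hsame j) v
  have hcomm : A * B = B * A := by
    apply hinj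
    rw [localOp_mul, localOp_mul, ← hB, hB', localOp_comm hij, ← hA, hA', localOp_comm hjk, ← hB',
      hB, localOp_comm hik]
  have hscalar (c : ℂ) : A ≠ c • 1 := by
    rintro rfl
    refine hv₀ (Submodule.mem_span_singleton.2 ⟨c, ?_⟩)
    rw [hA, localOp_smul_left, localOp_one]
  obtain ⟨x, y, hxy⟩ := exists_eq_of_commute_of_ne_smul_one hcomm hscalar
  refine ⟨x, y, ?_⟩
  rw [hA, hB, hxy, localOp_add_left, localOp_smul_left, localOp_smul_left, localOp_one]

end Qubits

/-- For a two-qubit pure state, a local unitary commuting with the reduced state of qubit `0`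
preserves both reduced states. -/
lemma ptrace_one_proj_localOp {ψ : (Fin 2 → Fin 2) → ℂ} {U R : Matrix (Fin 2) (Fin 2) ℂ}
    (hR : ∀ a b, R a b = ∑ c, ψ ![a, c] * star (ψ ![b, c])) (hUR : U * R * Uᴴ = R) :
    ptrace 1 (proj (localOp 0 U ψ)) = ptrace 1 (proj ψ) := by
  have hemb (x : {k : Fin 2 // k ≠ 1} → Fin 2) (b : Fin 2) :
      emb 1 x b = ![x ⟨0, by decide⟩, b] := by
    ext k
    fin_cases k <;> simp [emb]
  have hupd (a b c : Fin 2) : Function.update ![a, b] 0 c = ![c, b] := by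
    ext k
    fin_cases k <;> simp
  ext x y
  have h := congrFun (congrFun hUR (x ⟨0, by decide⟩)) (y ⟨0, by decide⟩)
  simp only [Matrix.mul_apply, Fin.sum_univ_two, hR, Matrix.conjTranspose_apply] at h
  simp only [ptrace, proj, Matrix.vecMulVec_apply, Pi.star_apply, hemb, localOp, hupd,
    Fin.sum_univ_two, star_add, star_mul', Matrix.cons_val_zero]
  linear_combination h

lemma exists_proj_ne_two_qubits {ψ : (Fin 2 → Fin 2) → ℂ} (hψ : star ψ ⬝ᵥ ψ = 1)
    (hinj : ∀ A, localOp 0 A ψ = 0 → A = 0) :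
    ∃ ψ' : (Fin 2 → Fin 2) → ℂ, star ψ' ⬝ᵥ ψ' = 1 ∧ proj ψ' ≠ proj ψ ∧
      ∀ j, ptrace j (proj ψ') = ptrace j (proj ψ) := by
  let R : Matrix (Fin 2) (Fin 2) ℂ := fun a b => ∑ c, ψ ![a, c] * star (ψ ![b, c])
  have hRH : R.IsHermitian := by
    ext a b
    rw [Matrix.conjTranspose_apply]
    simp [R, mul_comm]
  obtain ⟨v, r, hv, hRv⟩ : ∃ (v : Fin 2 → ℂ) (r : ℝ),
      star v ⬝ᵥ v = 1 ∧ R *ᵥ v = (r : ℂ) • v := by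
    have hne : (hRH.eigenvectorBasis 0).ofLp ≠ 0 := fun h0 =>
      hRH.eigenvectorBasis.orthonormal.ne_zero 0 (by ext i; exact congrFun h0 i)
    obtain ⟨c, -, hc⟩ := exists_unit_smul hne
    refine ⟨_, hRH.eigenvalues 0, hc, ?_⟩
    rw [Matrix.mulVec_smul, hRH.mulVec_eigenvectorBasis, smul_comm]
    rfl
  have hcomm : proj v * R = R * proj v := by
    have h1 : R * proj v = (r : ℂ) • proj v := by
      rw [proj, Matrix.mul_vecMulVec, hRv, Matrix.smul_vecMulVec]
    have h2 := congrArg Matrix.conjTranspose h1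
    rw [Matrix.conjTranspose_mul, hRH.eq, conjTranspose_proj, Matrix.conjTranspose_smul,
      conjTranspose_proj, RCLike.star_def, Complex.conj_ofReal] at h2
    rw [h1, h2]
  set U : Matrix (Fin 2) (Fin 2) ℂ := 1 - (2 : ℂ) • proj v with hUdef
  have hUH : Uᴴ = U := by
    simp [hUdef, conjTranspose_proj]
  have hUU : U * U = 1 := by
    simp only [hUdef, sub_mul, mul_sub, one_mul, mul_one, smul_mul_assoc, mul_smul_comm,
      proj_mul_self hv]
    module
  have hUR : U * R * Uᴴ = R := by
    have : U * R = R * U := by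
      simp [hUdef, sub_mul, mul_sub, hcomm]
    rw [hUH, this, mul_assoc, hUU, mul_one]
  have hunit : star (localOp 0 U ψ) ⬝ᵥ localOp 0 U ψ = 1 := by
    rw [star_localOp_dotProduct, ← localOp_mul, hUH, hUU, localOp_one, hψ]
  refine ⟨localOp 0 U ψ, hunit, fun heq => ?_, fun j => ?_⟩
  · obtain ⟨c, hc⟩ := eq_smul_of_proj_eq hunit heq
    have hUc : U = c • 1 := sub_eq_zero.1 (hinj _ (by
      rw [localOp_sub_left, hc, localOp_smul_left, localOp_one, sub_self]))
    have htrace := congrArg Matrix.trace hUc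
    have hvec := congrArg (fun M => star v ⬝ᵥ (M *ᵥ v)) hUc
    simp [hUdef, Matrix.sub_mulVec, Matrix.smul_mulVec, proj_mulVec, hv] at hvec
    simp [hUdef, proj, Matrix.trace_vecMulVec, dotProduct_comm v, hv] at htrace
    norm_num [htrace] at hvec
  · fin_cases j
    · exact ptrace_proj_localOp 0 (by rw [hUH, hUU]) ψ
    · exact ptrace_one_proj_localOp (fun _ _ => rfl) hUR

lemma exists_proj_ne_one_qubit {ψ : (Fin 1 → Fin 2) → ℂ} (hψ : star ψ ⬝ᵥ ψ = 1) :
    ∃ ψ' : (Fin 1 → Fin 2) → ℂ, star ψ' ⬝ᵥ ψ' = 1 ∧ proj ψ' ≠ proj ψ ∧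
      ∀ j, ptrace j (proj ψ') = ptrace j (proj ψ) := by
  have hptrace {φ : (Fin 1 → Fin 2) → ℂ} (hφ : star φ ⬝ᵥ φ = 1) (j : Fin 1) :
      ptrace j (proj φ) = fun _ _ => 1 := by
    obtain rfl : j = 0 := Subsingleton.elim _ _
    have : IsEmpty {k : Fin 1 // k ≠ 0} := ⟨fun k => k.2 (Subsingleton.elim _ _)⟩
    ext x y
    obtain rfl : x = y := Subsingleton.elim _ _
    rw [dotProduct, sum_emb 0, Fintype.sum_subsingleton _ x] at hφ
    rw [← hφ]
    simp [ptrace, proj, Matrix.vecMulVec_apply, mul_comm]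
  have hsingle (x : Fin 1 → Fin 2) :
      star (Pi.single x 1 : (Fin 1 → Fin 2) → ℂ) ⬝ᵥ Pi.single x 1 = 1 := by
    simp
  have hne : proj (Pi.single 0 1 : (Fin 1 → Fin 2) → ℂ) ≠ proj (Pi.single 1 1) := fun h => by
    have := congrFun (congrFun h 0) 0
    have h01 : (0 : Fin 1 → Fin 2) ≠ 1 := fun h => zero_ne_one (congrFun h 0)
    simp [proj, Matrix.vecMulVec_apply, h01] at this
  by_cases h : proj (Pi.single 0 1) = proj ψ
  · exact ⟨Pi.single 1 1, hsingle 1, fun h' => hne (h.trans h'.symm), fun j => by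
      rw [hptrace hψ, hptrace (hsingle 1)]⟩
  · exact ⟨Pi.single 0 1, hsingle 0, h, fun j => by rw [hptrace hψ, hptrace (hsingle 0)]⟩

/-- If an n-qubit pure state |ψ⟩⟨ψ| and a mixed (rank ≥ 2) density matrix ω
have the same reduced density matrices under every single-qubit partial trace,
then there is a pure state |ψ'⟩⟨ψ'| ≠ |ψ⟩⟨ψ| with the same reduced density
matrices as |ψ⟩. -/
theorem stmt5 {n : ℕ} (ψ : (Fin n → Fin 2) → ℂ) (hψ : star ψ ⬝ᵥ ψ = 1)
    (ω : Matrix (Fin n → Fin 2) (Fin n → Fin 2) ℂ)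
    (hω : ω.PosSemidef) (hωtr : ω.trace = 1) (hmixed : 2 ≤ ω.rank)
    (hsame : ∀ j : Fin n, ptrace j (proj ψ) = ptrace j ω) :
    ∃ ψ' : (Fin n → Fin 2) → ℂ, star ψ' ⬝ᵥ ψ' = 1 ∧
      proj ψ' ≠ proj ψ ∧
      ∀ j : Fin n, ptrace j (proj ψ') = ptrace j (proj ψ) := by
  match n with
  | 0 =>
    have hle := ω.rank_le_card_width
    simp only [Fintype.card_unique] at hle
    omega
  | 1 => exact exists_proj_ne_one_qubit hψ
  | 2 =>
    exact exists_proj_ne_two_qubits hψ fun A hA =>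
      eq_zero_of_localOp_eq_zero zero_ne_one hω hmixed hsame hA
  | m + 3 =>
    obtain ⟨φ, hφ⟩ := exists_plane_of_ptrace_eq (i := (⟨0, by omega⟩ : Fin (m + 3)))
      (j := ⟨1, by omega⟩) (k := ⟨2, by omega⟩) (by simp) (by simp) (by simp) hω hmixed hsame
    obtain ⟨ψ', hunit, hne, t, ht⟩ := exists_proj_on_line hψ hω hωtr hmixed hφ
    refine ⟨ψ', hunit, hne, fun j => ?_⟩
    ext x y
    have h := congrFun (congrFun (hsame j) x) y
    simp only [ptrace, Fin.sum_univ_two] at h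
    simp only [ht, ptrace, Fin.sum_univ_two, Matrix.add_apply, Matrix.smul_apply,
      Matrix.sub_apply, smul_eq_mul]
    linear_combination -t * h
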